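/- Let β > 0, let p, q ∈ (1,∞) with p ≠ q, let A, B ∈ (0,∞), and assume the complementary regime: (q ≤ α_p or B/A < r₂) and (p ≤ α_q or B/A > r₁). Then every maximizer u of ∫₀^∞ G(v(t)) dt over v ∈ 𝒞 attains equality in both constraints, i.e. p∫₀^∞ t^{p−1}u(t)dt = A^p and q∫₀^∞ t^{q−1}u(t)dt = B^q. -/

import Mathlib

open MeasureTheory Real Set
open scoped ENNReal

noncomputable section

/-- The function `G(s) = 1 - (1 + s/(4π))^(-2β)`. -/
def GFun (β s : ℝ) : ℝ := 1 - (1 + s / (4 * π)) ^ (-(2 * β))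

/-- `α_r = (r-1)/(2β+1)`. -/
def alphaC (β r : ℝ) : ℝ := (r - 1) / (2 * β + 1)

/-- `σ_r = (r-1)/(2βr+1)`. -/
def sigmaC (β r : ℝ) : ℝ := (r - 1) / (2 * β * r + 1)

/-- The threshold `r₁ = (4π)^(1/q-1/p) (α_q/(p-α_q))^(-1/p) σ_q^(1/q)`. -/
def rOne (β p q : ℝ) : ℝ :=
  (4 * π) ^ (1 / q - 1 / p) * (alphaC β q / (p - alphaC β q)) ^ (-(1 / p)) *
    sigmaC β q ^ (1 / q)

/-- The threshold `r₂ = (4π)^(1/q-1/p) (α_p/(q-α_p))^(1/q) σ_p^(-1/p)`. -/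
def rTwo (β p q : ℝ) : ℝ :=
  (4 * π) ^ (1 / q - 1 / p) * (alphaC β p / (q - alphaC β p)) ^ (1 / q) *
    sigmaC β p ^ (-(1 / p))

/-- The admissible class `𝒞`: nonincreasing `v : (0,∞) → [0,∞)` with
`p ∫₀^∞ t^(p-1) v(t) dt ≤ A^p` and `q ∫₀^∞ t^(q-1) v(t) dt ≤ B^q`. -/
def classC (p q A B : ℝ) : Set (ℝ → ℝ) :=
  {v | (∀ t ∈ Ioi (0 : ℝ), 0 ≤ v t) ∧ AntitoneOn v (Ioi 0) ∧
    ENNReal.ofReal p * ∫⁻ t in Ioi (0 : ℝ), ENNReal.ofReal (t ^ (p - 1) * v t) ≤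
      ENNReal.ofReal (A ^ p) ∧
    ENNReal.ofReal q * ∫⁻ t in Ioi (0 : ℝ), ENNReal.ofReal (t ^ (q - 1) * v t) ≤
      ENNReal.ofReal (B ^ q)}

/-- The objective functional `v ↦ ∫₀^∞ G(v(t)) dt` (as an extended-real integral). -/
def varObj (β : ℝ) (v : ℝ → ℝ) : ℝ≥0∞ :=
  ∫⁻ t in Ioi (0 : ℝ), ENNReal.ofReal (GFun β (v t))

/-- The weighted moment `∫₀^∞ t^(r-1) v(t) dt`. -/
def moment (r : ℝ) (v : ℝ → ℝ) : ℝ≥0∞ :=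
  ∫⁻ t in Ioi (0 : ℝ), ENNReal.ofReal (t ^ (r - 1) * v t)

/-- The derivative of `GFun β`. -/
def slopeG (β a : ℝ) : ℝ := 2 * β / (4 * π) * (1 + a / (4 * π)) ^ (-(2 * β) - 1)

/-- The maximizer `4π ((T/t)^{α_r} - 1)₊` of the problem with a single constraint. -/
def optProfile (β r T t : ℝ) : ℝ := 4 * π * max ((T / t) ^ alphaC β r - 1) 0

lemma GFun_lt_tangent {β a s : ℝ} (hβ : 0 < β) (ha : 0 ≤ a) (hs : 0 ≤ s) (hne : s ≠ a) :
    GFun β s < GFun β a + slopeG β a * (s - a) := by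
  have hπ : 0 < 4 * π := by positivity
  unfold GFun slopeG
  set x := 1 + a / (4 * π) with hx
  set y := 1 + s / (4 * π) with hy
  have hx0 : 0 < x := by positivity
  have hy0 : 0 < y := by positivity
  have hsa : s - a = 4 * π * (y - x) := by rw [hx, hy]; field_simp; ring
  have hyx : y / x ≠ 1 := by
    intro h
    rw [div_eq_one_iff_eq hx0.ne'] at h
    apply hne
    have : s - a = 0 := by rw [hsa, h]; ring
    linarith
  have hlog := Real.log_lt_sub_one_of_pos (div_pos hy0 hx0) hyx
  have hexp := Real.add_one_le_exp (-(2 * β) * Real.log (y / x))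
  have hpow : (y / x) ^ (-(2 * β)) = Real.exp (-(2 * β) * Real.log (y / x)) := by
    rw [Real.rpow_def_of_pos (div_pos hy0 hx0), mul_comm]
  have h1 : 1 - 2 * β * (y / x - 1) < (y / x) ^ (-(2 * β)) := by
    rw [hpow]; nlinarith
  have hxb : 0 < x ^ (-(2 * β)) := Real.rpow_pos_of_pos hx0 _
  have h2 := mul_lt_mul_of_pos_left h1 hxb
  rw [← Real.mul_rpow hx0.le (div_pos hy0 hx0).le, mul_div_cancel₀ y hx0.ne'] at h2
  rw [Real.rpow_sub_one hx0.ne', hsa]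
  have h3 : 2 * β / (4 * π) * (x ^ (-(2 * β)) / x) * (4 * π * (y - x))
      = x ^ (-(2 * β)) * (2 * β * (y / x - 1)) := by
    field_simp
  rw [h3]
  linarith

lemma GFun_le_tangent {β a s : ℝ} (hβ : 0 < β) (ha : 0 ≤ a) (hs : 0 ≤ s) :
    GFun β s ≤ GFun β a + slopeG β a * (s - a) := by
  rcases eq_or_ne s a with rfl | h
  · simp
  · exact (GFun_lt_tangent hβ ha hs h).le

lemma GFun_zero (β : ℝ) : GFun β 0 = 0 := by simp [GFun]

lemma slopeG_zero (β : ℝ) : slopeG β 0 = 2 * β / (4 * π) := by simp [slopeG]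

lemma GFun_mono {β a b : ℝ} (hβ : 0 < β) (ha : 0 ≤ a) (hab : a ≤ b) : GFun β a ≤ GFun β b := by
  unfold GFun
  have : (1 + b / (4 * π)) ^ (-(2 * β)) ≤ (1 + a / (4 * π)) ^ (-(2 * β)) :=
    Real.rpow_le_rpow_of_nonpos (by positivity) (by gcongr) (by linarith)
  linarith

lemma GFun_nonneg {β a : ℝ} (hβ : 0 < β) (ha : 0 ≤ a) : 0 ≤ GFun β a :=
  (GFun_zero β).symm.le.trans (GFun_mono hβ le_rfl ha)

lemma GFun_le_one {β a : ℝ} (ha : 0 ≤ a) : GFun β a ≤ 1 := by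
  unfold GFun
  have : 0 < (1 + a / (4 * π)) ^ (-(2 * β)) := Real.rpow_pos_of_pos (by positivity) _
  linarith

lemma GFun_concave {β a b ε : ℝ} (hβ : 0 < β) (ha : 0 ≤ a) (hb : 0 ≤ b) (h0 : 0 ≤ ε)
    (h1 : ε ≤ 1) :
    (1 - ε) * GFun β a + ε * GFun β b ≤ GFun β ((1 - ε) * a + ε * b) := by
  have hm : 0 ≤ (1 - ε) * a + ε * b := by have := sub_nonneg.2 h1; positivity
  have e1 := mul_le_mul_of_nonneg_left (GFun_le_tangent hβ hm ha) (sub_nonneg.2 h1)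
  have e2 := mul_le_mul_of_nonneg_left (GFun_le_tangent hβ hm hb) h0
  linarith

lemma measurable_GFun (β : ℝ) : Measurable (GFun β) := by
  unfold GFun; fun_prop

lemma measurable_optProfile (β r T : ℝ) : Measurable (optProfile β r T) := by
  unfold optProfile; fun_prop

lemma optProfile_nonneg (β r T t : ℝ) : 0 ≤ optProfile β r T t := by
  unfold optProfile; positivity

lemma alphaC_pos {β r : ℝ} (hβ : 0 < β) (hr : 1 < r) : 0 < alphaC β r :=
  div_pos (by linarith) (by linarith)

lemma alphaC_lt {β r : ℝ} (hβ : 0 < β) (hr : 1 < r) : alphaC β r < r := by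
  unfold alphaC
  rw [div_lt_iff₀ (by linarith)]
  nlinarith

lemma optProfile_of_le {β r T t : ℝ} (hβ : 0 < β) (hr : 1 < r) (ht : 0 < t) (htT : t ≤ T) :
    optProfile β r T t = 4 * π * ((T / t) ^ alphaC β r - 1) := by
  unfold optProfile
  rw [max_eq_left]
  exact sub_nonneg.2 (Real.one_le_rpow ((one_le_div ht).2 htT) (alphaC_pos hβ hr).le)

lemma optProfile_of_ge {β r T t : ℝ} (hβ : 0 < β) (hr : 1 < r) (hT : 0 < T) (htT : T ≤ t) :
    optProfile β r T t = 0 := by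
  unfold optProfile
  have ht := hT.trans_le htT
  rw [max_eq_right, mul_zero]
  exact sub_nonpos.2 (Real.rpow_le_one (by positivity) ((div_le_one ht).2 htT)
    (alphaC_pos hβ hr).le)

lemma optProfile_antitoneOn {β r T : ℝ} (hβ : 0 < β) (hr : 1 < r) (hT : 0 < T) :
    AntitoneOn (optProfile β r T) (Ioi 0) := by
  intro s hs t ht hst
  have hs' : 0 < s := hs
  have ht' : 0 < t := ht
  have := (alphaC_pos hβ hr).le
  unfold optProfile
  gcongr

/-- The strict Lagrangian inequality characterizing `optProfile` pointwise. -/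
lemma lagrangian_lt {β r T t s : ℝ} (hβ : 0 < β) (hr : 1 < r) (hT : 0 < T) (ht : 0 < t)
    (hs : 0 ≤ s) (hne : s ≠ optProfile β r T t) :
    GFun β s + 2 * β / (4 * π) / T ^ (r - 1) * (t ^ (r - 1) * optProfile β r T t) <
      GFun β (optProfile β r T t) + 2 * β / (4 * π) / T ^ (r - 1) * (t ^ (r - 1) * s) := by
  have key : ∀ x, 2 * β / (4 * π) / T ^ (r - 1) * (t ^ (r - 1) * x)
      = 2 * β / (4 * π) * (t / T) ^ (r - 1) * x := by
    intro x; rw [Real.div_rpow ht.le hT.le]; ring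
  rw [key, key]
  have htan := GFun_lt_tangent hβ (optProfile_nonneg β r T t) hs hne
  rcases le_total t T with h | h
  · have hsl : slopeG β (optProfile β r T t) = 2 * β / (4 * π) * (t / T) ^ (r - 1) := by
      unfold slopeG
      rw [optProfile_of_le hβ hr ht h]
      congr 1
      have hπ : (4 * π) ≠ 0 := by positivity
      rw [mul_div_cancel_left₀ _ hπ, add_sub_cancel, ← Real.rpow_mul (by positivity),
        ← inv_div t T, Real.inv_rpow (by positivity), ← Real.rpow_neg (by positivity)]
      congr 1
      unfold alphaC
      field_simp
      ring
    rw [hsl] at htan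
    linarith
  · rw [optProfile_of_ge hβ hr hT h] at htan ⊢
    rw [slopeG_zero] at htan
    have : 1 ≤ (t / T) ^ (r - 1) :=
      Real.one_le_rpow ((one_le_div hT).2 h) (by linarith)
    have h2 : 2 * β / (4 * π) * s * 1 ≤ 2 * β / (4 * π) * s * (t / T) ^ (r - 1) := by gcongr
    linarith

lemma moment_optProfile {β p q T : ℝ} (hβ : 0 < β) (hp : 1 < p) (hT : 0 < T) (hq : 0 < q)
    (hpq : alphaC β p < q) :
    moment q (optProfile β p T) =
      ENNReal.ofReal (4 * π * (T ^ q * (alphaC β p / (q * (q - alphaC β p))))) := by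
  set α := alphaC β p with hα
  have hα0 : 0 < α := alphaC_pos hβ hp
  have hi1 : IntervalIntegrable (fun t : ℝ => t ^ (q - 1 - α)) volume 0 T :=
    intervalIntegral.intervalIntegrable_rpow' (by linarith)
  have hi2 : IntervalIntegrable (fun t : ℝ => t ^ (q - 1)) volume 0 T :=
    intervalIntegral.intervalIntegrable_rpow' (by linarith)
  have hi := ((hi1.const_mul (T ^ α)).sub hi2).const_mul (4 * π)
  have hform : ∀ t ∈ Ioc 0 T, t ^ (q - 1) * optProfile β p T t
      = 4 * π * (T ^ α * t ^ (q - 1 - α) - t ^ (q - 1)) := by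
    intro t ht
    rw [optProfile_of_le hβ hp ht.1 ht.2, ← hα, Real.div_rpow hT.le ht.1.le,
      Real.rpow_sub ht.1 (q - 1) α]
    ring
  have htail : ∫⁻ t in Ioi T, ENNReal.ofReal (t ^ (q - 1) * optProfile β p T t) = 0 := by
    rw [setLIntegral_congr_fun measurableSet_Ioi (g := fun _ => 0)]
    · simp
    · intro t ht
      simp [optProfile_of_ge hβ hp hT (le_of_lt ht)]
  unfold moment
  rw [← Ioc_union_Ioi_eq_Ioi hT.le, lintegral_union measurableSet_Ioi Ioc_disjoint_Ioi_same,
    htail, add_zero]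
  rw [← ofReal_integral_eq_lintegral_ofReal]
  · congr 1
    rw [setIntegral_congr_fun measurableSet_Ioc hform, ← intervalIntegral.integral_of_le hT.le,
      intervalIntegral.integral_const_mul, intervalIntegral.integral_sub (hi1.const_mul _) hi2,
      intervalIntegral.integral_const_mul, integral_rpow (Or.inl (by linarith)),
      integral_rpow (Or.inl (by linarith)), sub_add_cancel, Real.zero_rpow hq.ne',
      Real.zero_rpow (by linarith : q - 1 - α + 1 ≠ 0), sub_zero, sub_zero, ← mul_div_assoc,
      ← Real.rpow_add hT, show α + (q - 1 - α + 1) = q by ring,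
      show q - 1 - α + 1 = q - α by ring]
    have : q - α ≠ 0 := by linarith
    field_simp
    ring
  · have h := (intervalIntegrable_iff_integrableOn_Ioc_of_le hT.le).1 hi
    exact h.congr_fun (fun t ht => (hform t ht).symm) measurableSet_Ioc
  · filter_upwards [ae_restrict_mem measurableSet_Ioc] with t ht
    exact mul_nonneg (Real.rpow_nonneg ht.1.le _) (optProfile_nonneg _ _ _ _)

lemma moment_optProfile_eq_top {β p q T : ℝ} (hβ : 0 < β) (hp : 1 < p) (hT : 0 < T)
    (hq : 1 < q) (hpq : q ≤ alphaC β p) :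
    moment q (optProfile β p T) = ∞ := by
  by_contra hfin
  set α := alphaC β p with hα
  have hint : IntegrableOn (fun t => t ^ (q - 1) * optProfile β p T t) (Ioi 0) := by
    refine ⟨?_, ?_⟩
    · have := measurable_optProfile β p T
      exact Measurable.aestronglyMeasurable (by fun_prop)
    · rw [hasFiniteIntegral_iff_ofReal]
      · exact lt_top_iff_ne_top.2 hfin
      · filter_upwards [ae_restrict_mem measurableSet_Ioi] with t ht
        exact mul_nonneg (Real.rpow_nonneg (le_of_lt ht) _) (optProfile_nonneg _ _ _ _)
  have h1 : IntegrableOn (fun t : ℝ => t ^ (q - 1)) (Ioo 0 T) :=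
    (intervalIntegral.integrableOn_Ioo_rpow_iff hT).2 (by linarith)
  have h2 := ((hint.mono_set (Ioo_subset_Ioi_self)).const_mul (4 * π)⁻¹).add h1
  have h3 : IntegrableOn (fun t : ℝ => t ^ (q - 1 - α)) (Ioo 0 T) := by
    refine IntegrableOn.congr_fun (h2.const_mul (T ^ α)⁻¹) ?_ measurableSet_Ioo
    intro t ht
    have hTα : T ^ α ≠ 0 := (Real.rpow_pos_of_pos hT _).ne'
    have htα : t ^ α ≠ 0 := (Real.rpow_pos_of_pos ht.1 _).ne'
    simp only [Pi.add_apply]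
    rw [optProfile_of_le hβ hp ht.1 ht.2.le, ← hα, Real.div_rpow hT.le ht.1.le,
      Real.rpow_sub ht.1 (q - 1) α]
    field_simp
    ring
  have := (intervalIntegral.integrableOn_Ioo_rpow_iff hT).1 h3
  linarith

lemma moment_convex_comb {r ε : ℝ} {u w : ℝ → ℝ} (hu : ∀ t ∈ Ioi (0 : ℝ), 0 ≤ u t)
    (hw : ∀ t ∈ Ioi (0 : ℝ), 0 ≤ w t) (hum : AEMeasurable u (volume.restrict (Ioi 0)))
    (h0 : 0 ≤ ε) (h1 : ε ≤ 1) :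
    moment r (fun t => (1 - ε) * u t + ε * w t) =
      ENNReal.ofReal (1 - ε) * moment r u + ENNReal.ofReal ε * moment r w := by
  unfold moment
  rw [← lintegral_const_mul' _ _ ENNReal.ofReal_ne_top,
    ← lintegral_const_mul' _ _ ENNReal.ofReal_ne_top, ← lintegral_add_left' (by fun_prop)]
  refine setLIntegral_congr_fun measurableSet_Ioi fun t ht => ?_
  have ht' : 0 ≤ t ^ (r - 1) := Real.rpow_nonneg (le_of_lt ht) _
  have h2 : 0 ≤ 1 - ε := sub_nonneg.2 h1
  have hut := hu t ht
  have hwt := hw t ht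
  simp only
  rw [← ENNReal.ofReal_mul h2, ← ENNReal.ofReal_mul h0,
    ← ENNReal.ofReal_add (by positivity) (by positivity)]
  congr 1
  ring

lemma varObj_convex_comb {β ε : ℝ} {u w : ℝ → ℝ} (hβ : 0 < β)
    (hu : ∀ t ∈ Ioi (0 : ℝ), 0 ≤ u t)
    (hw : ∀ t ∈ Ioi (0 : ℝ), 0 ≤ w t) (hum : AEMeasurable u (volume.restrict (Ioi 0)))
    (h0 : 0 ≤ ε) (h1 : ε ≤ 1) :
    ENNReal.ofReal (1 - ε) * varObj β u + ENNReal.ofReal ε * varObj β w ≤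
      varObj β (fun t => (1 - ε) * u t + ε * w t) := by
  unfold varObj
  have hGu : AEMeasurable (fun t => GFun β (u t)) (volume.restrict (Ioi 0)) :=
    (measurable_GFun β).comp_aemeasurable hum
  rw [← lintegral_const_mul' _ _ ENNReal.ofReal_ne_top,
    ← lintegral_const_mul' _ _ ENNReal.ofReal_ne_top,
    ← lintegral_add_left' (hGu.ennreal_ofReal.const_mul _)]
  refine setLIntegral_mono' measurableSet_Ioi fun t ht => ?_
  have h2 : 0 ≤ 1 - ε := sub_nonneg.2 h1
  have hut := GFun_nonneg hβ (hu t ht)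
  have hwt := GFun_nonneg hβ (hw t ht)
  rw [← ENNReal.ofReal_mul h2, ← ENNReal.ofReal_mul h0,
    ← ENNReal.ofReal_add (by positivity) (by positivity)]
  exact ENNReal.ofReal_le_ofReal (GFun_concave hβ (hu t ht) (hw t ht) h0 h1)

lemma varObj_ne_top {β p : ℝ} {u : ℝ → ℝ} (hβ : 0 < β) (hp : 1 < p)
    (hu : ∀ t ∈ Ioi (0 : ℝ), 0 ≤ u t) (hfin : moment p u ≠ ∞) : varObj β u ≠ ∞ := by
  have hbound : varObj β u ≤
      ∫⁻ t in Ioi (0 : ℝ), ((Ioc (0 : ℝ) 1).indicator 1 t +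
        ENNReal.ofReal (2 * β / (4 * π)) * ENNReal.ofReal (t ^ (p - 1) * u t)) := by
    refine setLIntegral_mono' measurableSet_Ioi fun t ht => ?_
    rcases le_total t 1 with h | h
    · refine le_add_right ?_
      rw [indicator_of_mem (show t ∈ Ioc (0 : ℝ) 1 from ⟨ht, h⟩)]
      exact ENNReal.ofReal_le_one.2 (GFun_le_one (hu t ht))
    · refine le_add_left ?_
      have hu0 := hu t ht
      rw [← ENNReal.ofReal_mul (by positivity)]
      refine ENNReal.ofReal_le_ofReal ?_
      have htan := GFun_le_tangent hβ le_rfl hu0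
      rw [GFun_zero, slopeG_zero, zero_add, sub_zero] at htan
      refine htan.trans ?_
      have : 1 ≤ t ^ (p - 1) := Real.one_le_rpow h (by linarith)
      exact mul_le_mul_of_nonneg_left (le_mul_of_one_le_left hu0 this) (by positivity)
  refine ne_top_of_le_ne_top ?_ hbound
  rw [lintegral_add_left (measurable_one.indicator measurableSet_Ioc),
    lintegral_const_mul' _ _ ENNReal.ofReal_ne_top, lintegral_indicator_one measurableSet_Ioc]
  refine ENNReal.add_ne_top.2 ⟨?_, ENNReal.mul_ne_top ENNReal.ofReal_ne_top hfin⟩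
  refine ne_top_of_le_ne_top ?_ (Measure.restrict_apply_le _ _)
  simp

/-- If a maximizer over `classC` leaves the second constraint slack, it beats every competitor
that satisfies the first constraint and has finite second moment. -/
lemma varObj_le_of_slack {β p q A B : ℝ} (hβ : 0 < β) (hp : 1 < p)
    {u w : ℝ → ℝ} (hu : u ∈ classC p q A B)
    (hmax : ∀ v ∈ classC p q A B, varObj β v ≤ varObj β u)
    (hslack : ENNReal.ofReal q * moment q u < ENNReal.ofReal (B ^ q))
    (hw0 : ∀ t ∈ Ioi (0 : ℝ), 0 ≤ w t) (hw : AntitoneOn w (Ioi 0))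
    (hwp : ENNReal.ofReal p * moment p w ≤ ENNReal.ofReal (A ^ p))
    (hwq : moment q w ≠ ∞) : varObj β w ≤ varObj β u := by
  obtain ⟨hu0, hua, hup, huq⟩ := hu
  change ENNReal.ofReal p * moment p u ≤ _ at hup
  have hum : AEMeasurable u (volume.restrict (Ioi 0)) :=
    aemeasurable_restrict_of_antitoneOn measurableSet_Ioi hua
  have hMp : moment p u ≠ ∞ := by
    intro h
    rw [h, ENNReal.mul_top (by simpa using by linarith)] at hup
    exact absurd hup (by simp)
  have hobj := varObj_ne_top hβ hp hu0 hMp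
  set a := ENNReal.ofReal q * moment q u with ha
  set b := ENNReal.ofReal q * moment q w with hb
  have hafin : a ≠ ∞ := hslack.ne_top
  have hbfin : b ≠ ∞ := ENNReal.mul_ne_top ENNReal.ofReal_ne_top hwq
  have hB0 : 0 < B ^ q := ENNReal.ofReal_pos.1 (bot_le.trans_lt hslack)
  have hd : 0 < B ^ q - a.toReal := by
    have := (ENNReal.lt_ofReal_iff_toReal_lt hafin).1 hslack
    linarith
  have hb1 : 0 < b.toReal + 1 := by positivity
  set ε := min (1 / 2) ((B ^ q - a.toReal) / (b.toReal + 1)) with hε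
  have hε0 : 0 < ε := lt_min (by norm_num) (div_pos hd hb1)
  have hε1 : ε ≤ 1 := (min_le_left _ _).trans (by norm_num)
  have hε2 : ε * (b.toReal + 1) ≤ B ^ q - a.toReal :=
    (le_div_iff₀ hb1).1 (min_le_right _ _)
  have hεc : 0 ≤ 1 - ε := sub_nonneg.2 hε1
  have hsum : ENNReal.ofReal (1 - ε) + ENNReal.ofReal ε = 1 := by
    rw [← ENNReal.ofReal_add hεc hε0.le]; simp
  have hmem : (fun t => (1 - ε) * u t + ε * w t) ∈ classC p q A B := by
    refine ⟨fun t ht => ?_, fun s hs t ht hst => ?_, ?_, ?_⟩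
    · have := hu0 t ht
      have := hw0 t ht
      positivity
    · have h1 := hua hs ht hst
      have h2 := hw hs ht hst
      simp only
      gcongr
    · change ENNReal.ofReal p * moment p _ ≤ _
      rw [moment_convex_comb hu0 hw0 hum hε0.le hε1]
      calc _ = ENNReal.ofReal (1 - ε) * (ENNReal.ofReal p * moment p u)
            + ENNReal.ofReal ε * (ENNReal.ofReal p * moment p w) := by ring
        _ ≤ ENNReal.ofReal (1 - ε) * ENNReal.ofReal (A ^ p)
            + ENNReal.ofReal ε * ENNReal.ofReal (A ^ p) := by gcongr
        _ = ENNReal.ofReal (A ^ p) := by rw [← add_mul, hsum, one_mul]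
    · change ENNReal.ofReal q * moment q _ ≤ _
      rw [moment_convex_comb hu0 hw0 hum hε0.le hε1]
      calc _ = ENNReal.ofReal (1 - ε) * a + ENNReal.ofReal ε * b := by rw [ha, hb]; ring
        _ = ENNReal.ofReal ((1 - ε) * a.toReal + ε * b.toReal) := by
          rw [ENNReal.ofReal_add (by positivity) (by positivity), ENNReal.ofReal_mul hεc,
            ENNReal.ofReal_mul hε0.le, ENNReal.ofReal_toReal hafin, ENNReal.ofReal_toReal hbfin]
        _ ≤ ENNReal.ofReal (B ^ q) := by
          refine ENNReal.ofReal_le_ofReal ?_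
          have : 0 ≤ ε * a.toReal := by positivity
          nlinarith
  have hle := (varObj_convex_comb hβ hu0 hw0 hum hε0.le hε1).trans (hmax _ hmem)
  have hsplit : varObj β u =
      ENNReal.ofReal (1 - ε) * varObj β u + ENNReal.ofReal ε * varObj β u := by
    rw [← add_mul, hsum, one_mul]
  have hle' := hle.trans hsplit.le
  have h3 := (ENNReal.add_le_add_iff_left
    (ENNReal.mul_ne_top ENNReal.ofReal_ne_top hobj)).1 hle'
  exact (ENNReal.mul_le_mul_iff_right (by simpa using hε0) ENNReal.ofReal_ne_top).1 h3

lemma moment_mono {r : ℝ} {v w : ℝ → ℝ} (h : ∀ t ∈ Ioi (0 : ℝ), v t ≤ w t) :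
    moment r v ≤ moment r w :=
  setLIntegral_mono' measurableSet_Ioi fun t ht => ENNReal.ofReal_le_ofReal
    (mul_le_mul_of_nonneg_left (h t ht) (Real.rpow_nonneg (le_of_lt ht) _))

lemma moment_min_optProfile_ne_top {β p q T : ℝ} (hβ : 0 < β) (hp : 1 < p) (hT : 0 < T)
    (hq : 1 < q) (n : ℕ) : moment q (fun t => min (optProfile β p T t) n) ≠ ∞ := by
  have hbound : moment q (fun t => min (optProfile β p T t) n) ≤
      ∫⁻ t in Ioi (0 : ℝ),
        (Ioc (0 : ℝ) T).indicator (fun _ => ENNReal.ofReal (T ^ (q - 1) * n)) t := by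
    refine setLIntegral_mono' measurableSet_Ioi fun t ht => ?_
    have ht' : 0 < t := ht
    rcases le_or_gt t T with h | h
    · rw [indicator_of_mem (show t ∈ Ioc (0 : ℝ) T from ⟨ht, h⟩)]
      refine ENNReal.ofReal_le_ofReal ?_
      have := le_min (optProfile_nonneg β p T t) (Nat.cast_nonneg (α := ℝ) n)
      have h1 : t ^ (q - 1) ≤ T ^ (q - 1) := Real.rpow_le_rpow ht'.le h (by linarith)
      exact mul_le_mul h1 (min_le_right _ _) this (by positivity)
    · simp [optProfile_of_ge hβ hp hT h.le]
  refine ne_top_of_le_ne_top ?_ hbound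
  rw [lintegral_indicator_const measurableSet_Ioc]
  refine ENNReal.mul_ne_top ENNReal.ofReal_ne_top ?_
  refine ne_top_of_le_ne_top ?_ (Measure.restrict_apply_le _ _)
  simp

lemma varObj_optProfile_le {β p T : ℝ} (hβ : 0 < β) {c : ℝ≥0∞}
    (h : ∀ n : ℕ, varObj β (fun t => min (optProfile β p T t) n) ≤ c) :
    varObj β (optProfile β p T) ≤ c := by
  have hm := measurable_optProfile β p T
  have hG := measurable_GFun β
  refine le_of_tendsto' (lintegral_tendsto_of_tendsto_of_monotone
    (f := fun (n : ℕ) t => ENNReal.ofReal (GFun β (min (optProfile β p T t) n))) ?_ ?_ ?_) h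
  · intro n
    exact (hG.comp (hm.min measurable_const)).ennreal_ofReal.aemeasurable
  · refine Filter.Eventually.of_forall fun t m n hmn => ENNReal.ofReal_le_ofReal
      (GFun_mono hβ (le_min (optProfile_nonneg β p T t) (Nat.cast_nonneg m)) ?_)
    gcongr
  · refine Filter.Eventually.of_forall fun t => tendsto_const_nhds.congr' ?_
    obtain ⟨N, hN⟩ := exists_nat_ge (optProfile β p T t)
    filter_upwards [Filter.eventually_ge_atTop N] with n hn
    rw [min_eq_left (hN.trans (by exact_mod_cast hn))]

/-- The maximizer of the problem with a single constraint is unique. -/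
lemma ae_eq_optProfile {β p T : ℝ} (hβ : 0 < β) (hp : 1 < p) (hT : 0 < T) {u : ℝ → ℝ}
    (hu0 : ∀ t ∈ Ioi (0 : ℝ), 0 ≤ u t) (hum : AEMeasurable u (volume.restrict (Ioi 0)))
    (hmom : moment p u ≤ moment p (optProfile β p T))
    (hmomfin : moment p (optProfile β p T) ≠ ∞)
    (hobj : varObj β (optProfile β p T) ≤ varObj β u) :
    u =ᵐ[volume.restrict (Ioi 0)] optProfile β p T := by
  set w := optProfile β p T with hw
  have hw0 : ∀ t, 0 ≤ w t := optProfile_nonneg β p T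
  have hwm : Measurable w := measurable_optProfile β p T
  set k := 2 * β / (4 * π) / T ^ (p - 1) with hk
  have hk0 : 0 ≤ k := by positivity
  have hGm := measurable_GFun β
  have hGu : AEMeasurable (fun t => ENNReal.ofReal (GFun β (u t))) (volume.restrict (Ioi 0)) :=
    (hGm.comp_aemeasurable hum).ennreal_ofReal
  have hGw : Measurable fun t => ENNReal.ofReal (GFun β (w t)) := (hGm.comp hwm).ennreal_ofReal
  have hobjfin : varObj β u ≠ ∞ :=
    varObj_ne_top hβ hp hu0 (ne_top_of_le_ne_top hmomfin hmom)
  set f : ℝ → ℝ≥0∞ := fun t => ENNReal.ofReal (GFun β (u t)) +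
    ENNReal.ofReal k * ENNReal.ofReal (t ^ (p - 1) * w t)
  set g : ℝ → ℝ≥0∞ := fun t => ENNReal.ofReal (GFun β (w t)) +
    ENNReal.ofReal k * ENNReal.ofReal (t ^ (p - 1) * u t)
  have hf : ∫⁻ t in Ioi (0 : ℝ), f t = varObj β u + ENNReal.ofReal k * moment p w := by
    rw [lintegral_add_left' hGu,
      lintegral_const_mul' _ _ ENNReal.ofReal_ne_top]
    rfl
  have hg : ∫⁻ t in Ioi (0 : ℝ), g t = varObj β w + ENNReal.ofReal k * moment p u := by
    rw [lintegral_add_left hGw,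
      lintegral_const_mul' _ _ ENNReal.ofReal_ne_top]
    rfl
  have hfr : ∀ t ∈ Ioi (0 : ℝ), f t = ENNReal.ofReal (GFun β (u t) + k * (t ^ (p - 1) * w t)) := by
    intro t ht
    have := Real.rpow_nonneg (le_of_lt ht) (p - 1)
    have := hw0 t
    rw [ENNReal.ofReal_add (GFun_nonneg hβ (hu0 t ht)) (by positivity), ENNReal.ofReal_mul hk0]
  have hgr : ∀ t ∈ Ioi (0 : ℝ), g t = ENNReal.ofReal (GFun β (w t) + k * (t ^ (p - 1) * u t)) := by
    intro t ht
    have := Real.rpow_nonneg (le_of_lt ht) (p - 1)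
    have := hu0 t ht
    rw [ENNReal.ofReal_add (GFun_nonneg hβ (hw0 t)) (by positivity), ENNReal.ofReal_mul hk0]
  have hlt : ∀ t ∈ Ioi (0 : ℝ), u t ≠ w t → f t < g t := by
    intro t ht hne
    have hL := lagrangian_lt hβ hp hT ht (hu0 t ht) hne
    rw [hfr t ht, hgr t ht, ENNReal.ofReal_lt_ofReal_iff']
    refine ⟨hL, lt_of_le_of_lt ?_ hL⟩
    have := Real.rpow_nonneg (le_of_lt ht) (p - 1)
    have := GFun_nonneg hβ (hu0 t ht)
    have := optProfile_nonneg β p T t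
    positivity
  have hfg : f ≤ᵐ[volume.restrict (Ioi 0)] g := by
    filter_upwards [ae_restrict_mem measurableSet_Ioi] with t ht
    by_cases h : u t = w t
    · simp only [f, g, h]; exact le_rfl
    · exact (hlt t ht h).le
  have hae := ae_eq_of_ae_le_of_lintegral_le hfg
    (by rw [hf]; exact ENNReal.add_ne_top.2
          ⟨hobjfin, ENNReal.mul_ne_top ENNReal.ofReal_ne_top hmomfin⟩)
    (by simp only [g]
        exact hGw.aemeasurable.add (by fun_prop))
    (by rw [hf, hg]; gcongr)
  filter_upwards [hae, ae_restrict_mem measurableSet_Ioi] with t h ht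
  by_contra hne
  exact (hlt t ht hne).ne h

lemma alphaC_div_eq_sigmaC {β r : ℝ} (hβ : 0 < β) (hr : 1 < r) :
    alphaC β r / (r - alphaC β r) = sigmaC β r := by
  have h1 := alphaC_lt hβ hr
  have h2 : 0 < 2 * β + 1 := by linarith
  have h3 : 0 < 2 * β * r + 1 := by positivity
  have h4 : r - alphaC β r = (2 * β * r + 1) / (2 * β + 1) := by
    unfold alphaC; field_simp; ring
  rw [h4]
  unfold alphaC sigmaC
  field_simp

lemma sigmaC_pos {β r : ℝ} (hβ : 0 < β) (hr : 1 < r) : 0 < sigmaC β r :=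
  div_pos (by linarith) (by positivity)

/-- In the regime `q ≤ α_p` or `B / A < r₂` every maximizer saturates the second constraint. -/
lemma second_constraint_saturated {β p q A B : ℝ} (hβ : 0 < β) (hp : 1 < p) (hq : 1 < q)
    (hA : 0 < A) (hB : 0 < B) (hreg : q ≤ alphaC β p ∨ B / A < rTwo β p q)
    {u : ℝ → ℝ} (hu : u ∈ classC p q A B)
    (hmax : ∀ v ∈ classC p q A B, varObj β v ≤ varObj β u) :
    ENNReal.ofReal q * moment q u = ENNReal.ofReal (B ^ q) := by
  by_contra hne
  have hslack : ENNReal.ofReal q * moment q u < ENNReal.ofReal (B ^ q) :=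
    lt_of_le_of_ne hu.2.2.2 hne
  have hσ := sigmaC_pos hβ hp
  have hp0 : 0 < p := by linarith
  have hq0 : 0 < q := by linarith
  set T := A * (4 * π * sigmaC β p) ^ (-(1 / p)) with hTdef
  have hT : 0 < T := by positivity
  have hTp : 4 * π * sigmaC β p * T ^ p = A ^ p := by
    rw [hTdef, Real.mul_rpow hA.le (by positivity), ← Real.rpow_mul (by positivity),
      show -(1 / p) * p = -1 by field_simp, Real.rpow_neg_one]
    field_simp
  have hval : moment p (optProfile β p T) =
      ENNReal.ofReal (4 * π * (T ^ p * (alphaC β p / (p * (p - alphaC β p))))) :=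
    moment_optProfile hβ hp hT hp0 (alphaC_lt hβ hp)
  have hMp : ENNReal.ofReal p * moment p (optProfile β p T) = ENNReal.ofReal (A ^ p) := by
    rw [hval, ← ENNReal.ofReal_mul hp0.le, ← hTp, ← alphaC_div_eq_sigmaC hβ hp]
    congr 1
    have := (sub_pos.2 (alphaC_lt hβ hp)).ne'
    field_simp
  have hum : AEMeasurable u (volume.restrict (Ioi 0)) :=
    aemeasurable_restrict_of_antitoneOn measurableSet_Ioi hu.2.1
  have hobj : varObj β (optProfile β p T) ≤ varObj β u := by
    refine varObj_optProfile_le hβ fun n =>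
      varObj_le_of_slack hβ hp hu hmax hslack ?_ ?_ ?_
        (moment_min_optProfile_ne_top hβ hp hT hq n)
    · exact fun t _ => le_min (optProfile_nonneg β p T t) (Nat.cast_nonneg n)
    · intro s hs t ht hst
      exact min_le_min_right _ (optProfile_antitoneOn hβ hp hT hs ht hst)
    · rw [← hMp]
      gcongr
      exact moment_mono fun t _ => min_le_left _ _
  have hmom : moment p u ≤ moment p (optProfile β p T) := by
    have : ENNReal.ofReal p * moment p u ≤ ENNReal.ofReal p * moment p (optProfile β p T) := by
      rw [hMp]; exact hu.2.2.1
    exact (ENNReal.mul_le_mul_iff_right (by simpa using hp0) ENNReal.ofReal_ne_top).1 this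
  have hae := ae_eq_optProfile hβ hp hT hu.1 hum hmom (by rw [hval]; exact ENNReal.ofReal_ne_top)
    hobj
  have hMq : moment q u = moment q (optProfile β p T) := by
    refine lintegral_congr_ae ?_
    filter_upwards [hae] with t ht
    rw [ht]
  rw [hMq] at hslack
  rcases le_or_gt q (alphaC β p) with hqa | hqa
  · rw [moment_optProfile_eq_top hβ hp hT hq hqa, ENNReal.mul_top (by simpa using hq0)] at hslack
    exact absurd hslack (by simp)
  · have hr := hreg.resolve_left (not_le.2 hqa)
    have hα := alphaC_pos hβ hp
    have hqα : 0 < q - alphaC β p := sub_pos.2 hqa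
    set E := alphaC β p / (q - alphaC β p) with hE
    have hE0 : 0 < E := div_pos hα hqα
    have hAr : A * rTwo β p q = T * (4 * π * E) ^ (1 / q) := by
      unfold rTwo
      rw [hTdef, Real.mul_rpow (by positivity) hσ.le, Real.mul_rpow (by positivity) hE0.le,
        sub_eq_add_neg, Real.rpow_add (by positivity), hE]
      ring
    have hBlt : B < T * (4 * π * E) ^ (1 / q) := by
      rw [← hAr]
      exact (div_lt_iff₀' hA).1 hr
    have hBq : B ^ q < T ^ q * (4 * π * E) := by
      have := Real.rpow_lt_rpow hB.le hBlt hq0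
      rwa [Real.mul_rpow hT.le (by positivity), ← Real.rpow_mul (by positivity),
        one_div_mul_cancel hq0.ne', Real.rpow_one] at this
    rw [moment_optProfile hβ hp hT hq0 hqa, ← ENNReal.ofReal_mul hq0.le] at hslack
    refine absurd hslack (not_lt.2 (ENNReal.ofReal_le_ofReal (hBq.le.trans_eq ?_)))
    rw [hE]
    field_simp

lemma classC_swap (p q A B : ℝ) : classC p q A B = classC q p B A := by
  ext v
  constructor <;> exact fun ⟨h0, h1, h2, h3⟩ => ⟨h0, h1, h3, h2⟩

lemma inv_rOne {β p q : ℝ} (hβ : 0 < β) (hq : 1 < q) (hpq : alphaC β q < p) :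
    (rOne β p q)⁻¹ = rTwo β q p := by
  have hE : 0 ≤ alphaC β q / (p - alphaC β q) :=
    (div_pos (alphaC_pos hβ hq) (sub_pos.2 hpq)).le
  unfold rOne rTwo
  rw [mul_inv, mul_inv, ← Real.rpow_neg (by positivity), ← Real.rpow_neg hE,
    ← Real.rpow_neg (sigmaC_pos hβ hq).le, neg_sub, neg_neg]

/-- In the complementary regime, every maximizer of
`∫₀^∞ G(v(t)) dt` over `𝒞` attains equality in both constraints. -/
theorem maximizer_saturates_both_constraints
    (β p q A B : ℝ) (hβ : 0 < β)
    (hp : 1 < p) (hq : 1 < q) (hpq : p ≠ q) (hA : 0 < A) (hB : 0 < B)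
    (hreg₁ : q ≤ alphaC β p ∨ B / A < rTwo β p q)
    (hreg₂ : p ≤ alphaC β q ∨ rOne β p q < B / A)
    (u : ℝ → ℝ) (hu : u ∈ classC p q A B)
    (hmax : ∀ v ∈ classC p q A B, varObj β v ≤ varObj β u) :
    ENNReal.ofReal p * ∫⁻ t in Ioi (0 : ℝ), ENNReal.ofReal (t ^ (p - 1) * u t) =
      ENNReal.ofReal (A ^ p) ∧
    ENNReal.ofReal q * ∫⁻ t in Ioi (0 : ℝ), ENNReal.ofReal (t ^ (q - 1) * u t) =
      ENNReal.ofReal (B ^ q) := by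
  refine ⟨?_, second_constraint_saturated hβ hp hq hA hB hreg₁ hu hmax⟩
  rw [classC_swap] at hu hmax
  refine second_constraint_saturated hβ hq hp hB hA ?_ hu hmax
  rcases le_or_gt p (alphaC β q) with h | h
  · exact Or.inl h
  · right
    have h1 := hreg₂.resolve_left (not_le.2 h)
    have hE := div_pos (alphaC_pos hβ hq) (sub_pos.2 h)
    have hr : 0 < rOne β p q := by
      have := sigmaC_pos hβ hq
      unfold rOne
      positivity
    rw [← inv_rOne hβ hq h, ← inv_div B A]
    exact inv_strictAnti₀ hr h1

end
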